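/- Let W be an increasing filtration of V and let N̂, H be endomorphisms of V. If Y₁ and Y₂ are gradings of W with [Y_i, N̂] = 0 and [Y_i, H] = 0 for i = 1, 2, then there exists a unique endomorphism α of V with α(W_k) ⊆ W_{k−1} for all k, [α, N̂] = 0, [α, H] = 0, and exp(α) ∘ Y₁ ∘ exp(α)⁻¹ = Y₂. (Such α is nilpotent since it strictly lowers the finite filtration W, so exp(α) is a well-defined automorphism; the statement says that the gradings of W commuting with N̂ and H form a set on which the group exp of the degree-(−1) centralizer acts simply transitively.) -/

import Mathlib

/-- An increasing filtration of `V`: an increasing family of subspaces indexed by `ℤ`,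
eventually `⊥` below and eventually `⊤` above. -/
def IsIncFilt {K V : Type} [Field K] [AddCommGroup V] [Module K V]
    (W : ℤ → Submodule K V) : Prop :=
  Monotone W ∧ (∃ a : ℤ, ∀ k ≤ a, W k = ⊥) ∧ (∃ b : ℤ, ∀ k, b ≤ k → W k = ⊤)

/-- The `j`-eigenspace `E_j(Y) = ker (Y - j·1)` of an endomorphism, for an integer `j`. -/
def intEig {K V : Type} [Field K] [AddCommGroup V] [Module K V]
    (Y : Module.End K V) (j : ℤ) : Submodule K V :=
  LinearMap.ker (Y - (j : K) • (1 : Module.End K V))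

/-- `Y` is a grading of the filtration `W`: `Y` is semisimple with integer eigenvalues
(`V` is the direct sum of the integer eigenspaces, whose mutual independence is automatic)
and `W k = ⊕_{j ≤ k} E_j(Y)` for all `k`. -/
def IsGrading {K V : Type} [Field K] [AddCommGroup V] [Module K V]
    (Y : Module.End K V) (W : ℤ → Submodule K V) : Prop :=
  (⨆ j : ℤ, intEig Y j) = ⊤ ∧ ∀ k : ℤ, W k = ⨆ j ≤ k, intEig Y j

/-- The adjoint action `ad Y = [Y, ·]` on `End(V)`. -/
def adE {K V : Type} [Field K] [AddCommGroup V] [Module K V]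
    (Y : Module.End K V) : Module.End K (Module.End K V) :=
  LinearMap.mulLeft K Y - LinearMap.mulRight K Y

/-- `M` is the relative weight filtration of `N` with respect to `W`:
`N(M_k) ⊆ M_{k-2}`, and for all `k ∈ ℤ` and `ℓ ≥ 0` the map induced by `N^ℓ` from
`Gr^M_{k+ℓ} Gr^W_k` to `Gr^M_{k-ℓ} Gr^W_k` is an isomorphism (expressed here as surjectivity
and injectivity conditions on the corresponding submodules of `V`). -/
def IsRelWeightFilt {K V : Type} [Field K] [AddCommGroup V] [Module K V]
    (N : Module.End K V) (W M : ℤ → Submodule K V) : Prop :=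
  (∀ k : ℤ, Submodule.map N (M k) ≤ M (k - 2)) ∧
  ∀ (k : ℤ) (ℓ : ℕ),
    (M (k - ℓ) ⊓ W k ≤
      Submodule.map (N ^ ℓ) (M (k + ℓ) ⊓ W k) ⊔ ((M (k - ℓ - 1) ⊓ W k) ⊔ W (k - 1))) ∧
    ((M (k + ℓ) ⊓ W k) ⊓
        Submodule.comap (N ^ ℓ) ((M (k - ℓ - 1) ⊓ W k) ⊔ W (k - 1)) ≤
      (M (k + ℓ - 1) ⊓ W k) ⊔ W (k - 1))

/-- A one-variable Deligne system `(W, N, Y)`: `W` an increasing filtration, `N` a nilpotent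
endomorphism preserving `W`, and `Y` a grading of an increasing filtration `M` of `V` such
that `Y` preserves `W`, `[Y, N] = -2N`, and `M` is the relative weight filtration of `N`
with respect to `W`. -/
def IsDeligneSystem1 {K V : Type} [Field K] [AddCommGroup V] [Module K V]
    (W : ℤ → Submodule K V) (N Y : Module.End K V) : Prop :=
  IsIncFilt W ∧ IsNilpotent N ∧ (∀ k : ℤ, Submodule.map N (W k) ≤ W k) ∧
  ∃ M : ℤ → Submodule K V, IsIncFilt M ∧ IsGrading Y M ∧
    (∀ k : ℤ, Submodule.map Y (W k) ≤ W k) ∧ (Y * N - N * Y = -(2 • N)) ∧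
    IsRelWeightFilt N W M

/-- `N₀` is the component of `N` in the `0`-eigenspace of `ad Y'`: `[Y', N₀] = 0` and
`N - N₀` lies in the sum of the nonzero integer eigenspaces of `ad Y'`. -/
def IsZeroComponent {K V : Type} [Field K] [AddCommGroup V] [Module K V]
    (Y' N N₀ : Module.End K V) : Prop :=
  adE Y' N₀ = 0 ∧
  N - N₀ ∈ ⨆ j ∈ {j : ℤ | j ≠ 0},
    LinearMap.ker (adE Y' - (j : K) • (1 : Module.End K (Module.End K V)))

/-- `(N⁺, Y, N)` is a standard triple: `[Y, N⁺] = 2N⁺`, `[N⁺, N] = Y`, `[Y, N] = -2N`. -/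
def IsStdTriple {K V : Type} [Field K] [AddCommGroup V] [Module K V]
    (Np Y N : Module.End K V) : Prop :=
  Y * Np - Np * Y = 2 • Np ∧ Np * N - N * Np = Y ∧ Y * N - N * Y = -(2 • N)

/-- `Y'` has the Deligne grading property for `(N, Y)`: there exist `N₀⁺` commuting with `Y'`
such that `(N₀⁺, Y - Y', N₀)` is a standard triple and `[N - N₀, N₀⁺] = 0`, where `N₀` is the
component of `N` in the `0`-eigenspace of `ad Y'`. -/
def HasDGP {K V : Type} [Field K] [AddCommGroup V] [Module K V]
    (N Y Y' : Module.End K V) : Prop :=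
  ∃ N₀ Np : Module.End K V, IsZeroComponent Y' N N₀ ∧ adE Y' Np = 0 ∧
    IsStdTriple Np (Y - Y') N₀ ∧ (N - N₀) * Np = Np * (N - N₀)

/-- The exponential of an endomorphism of a finite-dimensional space, as the truncated
exponential series `Σ_{i ≤ dim V} α^i / i!`; for nilpotent `α` (e.g. any endomorphism
strictly lowering a finite exhaustive filtration) this is the usual exponential. -/
noncomputable def nexp {K V : Type} [Field K] [CharZero K] [AddCommGroup V] [Module K V]
    [FiniteDimensional K V] (α : Module.End K V) : Module.End K V :=
  ∑ i ∈ Finset.range (Module.finrank K V + 1), ((i.factorial : K))⁻¹ • α ^ i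

section Lowering

variable {K V : Type} [Field K] [AddCommGroup V] [Module K V]

/-- The endomorphisms lowering the filtration `W` by at least `m` steps. -/
def lowering (W : ℤ → Submodule K V) (m : ℤ) : Submodule K (Module.End K V) where
  carrier := {f | ∀ k, ∀ v ∈ W k, f v ∈ W (k - m)}
  zero_mem' := fun _ _ _ => by simp
  add_mem' := fun hf hg k v hv => add_mem (hf k v hv) (hg k v hv)
  smul_mem' := fun c _ hf k v hv => Submodule.smul_mem _ c (hf k v hv)

theorem mem_lowering {W : ℤ → Submodule K V} {m : ℤ} {f : Module.End K V} :
    f ∈ lowering W m ↔ ∀ k, ∀ v ∈ W k, f v ∈ W (k - m) := Iff.rfl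

theorem mem_lowering_one_iff {W : ℤ → Submodule K V} {f : Module.End K V} :
    f ∈ lowering W 1 ↔ ∀ k, Submodule.map f (W k) ≤ W (k - 1) := by
  simp only [mem_lowering, Submodule.map_le_iff_le_comap]
  rfl

theorem mul_mem_lowering {W : ℤ → Submodule K V} {m n p : ℤ} (hp : m + n = p)
    {f g : Module.End K V} (hf : f ∈ lowering W m) (hg : g ∈ lowering W n) :
    f * g ∈ lowering W p := by
  intro k v hv
  have := hf _ _ (hg k v hv)
  rwa [show k - n - m = k - p by lia] at this

theorem pow_mem_lowering {W : ℤ → Submodule K V} {f : Module.End K V}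
    (hf : f ∈ lowering W 1) (n : ℕ) : f ^ n ∈ lowering W n := by
  induction n with
  | zero => exact fun k v hv => by simpa using hv
  | succ n ih => exact pow_succ f n ▸ mul_mem_lowering (by push_cast; rfl) ih hf

theorem lowering_antitone {W : ℤ → Submodule K V} (hW : Monotone W) : Antitone (lowering W) :=
  fun _ _ hmn _ hf k v hv => hW (by lia) (hf k v hv)

theorem exists_eq_zero_of_mem_lowering {W : ℤ → Submodule K V} (hW : IsIncFilt W) :
    ∃ n : ℕ, ∀ f ∈ lowering W n, f = 0 := by
  obtain ⟨-, ⟨a, ha⟩, b, hb⟩ := hW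
  refine ⟨(b - a).toNat, fun f hf => LinearMap.ext fun v => ?_⟩
  have := hf b v (by simp [hb b le_rfl])
  rwa [ha _ (by lia), Submodule.mem_bot] at this

theorem isNilpotent_of_mem_lowering {W : ℤ → Submodule K V} (hW : IsIncFilt W)
    {f : Module.End K V} (hf : f ∈ lowering W 1) : IsNilpotent f := by
  obtain ⟨n, hn⟩ := exists_eq_zero_of_mem_lowering hW
  exact ⟨n, hn _ (pow_mem_lowering hf n)⟩

theorem pow_succ_sub_pow_succ_mem_lowering {W : ℤ → Submodule K V} {m : ℤ}
    {a b : Module.End K V} (ha : a ∈ lowering W 1) (hb : b ∈ lowering W 1)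
    (hab : a - b ∈ lowering W m) (i : ℕ) :
    a ^ (i + 1) - b ^ (i + 1) ∈ lowering W (m + i) := by
  induction i with
  | zero => simpa using hab
  | succ i ih =>
    have key : a ^ (i + 1 + 1) - b ^ (i + 1 + 1)
        = a * (a ^ (i + 1) - b ^ (i + 1)) + (a - b) * b ^ (i + 1) := by
      rw [pow_succ' a, pow_succ' b (i + 1)]; noncomm_ring
    rw [key]
    exact add_mem (mul_mem_lowering (by push_cast; ring) ha ih)
      (mul_mem_lowering rfl hab (pow_mem_lowering hb _))

end Lowering

section Exponential

variable {K V : Type} [Field K] [CharZero K] [AddCommGroup V] [Module K V]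
  [FiniteDimensional K V]

theorem nexp_sub_nexp_sub_mem_lowering {W : ℤ → Submodule K V} (hW : Monotone W) {m : ℤ}
    {a b : Module.End K V} (ha : a ∈ lowering W 1) (hb : b ∈ lowering W 1)
    (hab : a - b ∈ lowering W m) :
    nexp a - nexp b - (a - b) ∈ lowering W (m + 1) := by
  unfold nexp
  rcases Nat.eq_zero_or_pos (Module.finrank K V) with h | h
  · have := Module.finrank_zero_iff.mp h
    rw [Subsingleton.elim (_ - _ - _) (0 : Module.End K V)]
    exact zero_mem _
  · obtain ⟨n, hn⟩ := Nat.exists_eq_add_one.mpr h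
    rw [hn, Finset.sum_range_succ', Finset.sum_range_succ', Finset.sum_range_succ' _ (n + 1),
      Finset.sum_range_succ' _ n]
    have key : ∀ x y : Module.End K V, x + ((0 + 1).factorial : K)⁻¹ • a ^ (0 + 1)
          + ((Nat.factorial 0 : ℕ) : K)⁻¹ • a ^ 0
        - (y + ((0 + 1).factorial : K)⁻¹ • b ^ (0 + 1) + ((Nat.factorial 0 : ℕ) : K)⁻¹ • b ^ 0)
        - (a - b) = x - y := by
      intro x y; simp; abel
    rw [key, ← Finset.sum_sub_distrib]
    refine sum_mem fun i _ => ?_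
    rw [← smul_sub]
    refine Submodule.smul_mem _ _ (lowering_antitone hW ?_
      (pow_succ_sub_pow_succ_mem_lowering ha hb hab (i + 1)))
    push_cast; lia

theorem nexp_zero : nexp (0 : Module.End K V) = 1 := by
  simp [nexp, Finset.sum_range_succ']

theorem nexp_sub_one_mem_lowering {W : ℤ → Submodule K V} (hW : Monotone W)
    {a : Module.End K V} (ha : a ∈ lowering W 1) : nexp a - 1 ∈ lowering W 1 := by
  have h := nexp_sub_nexp_sub_mem_lowering hW ha (zero_mem _) (by simpa using ha)
  rw [nexp_zero, sub_zero] at h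
  simpa using add_mem (lowering_antitone hW (by lia) h) ha

theorem nexp_injOn_lowering {W : ℤ → Submodule K V} (hW : IsIncFilt W) :
    Set.InjOn (nexp : Module.End K V → Module.End K V) (lowering W 1) := by
  intro a ha b hb hab
  have key : ∀ n : ℕ, a - b ∈ lowering W (n + 1) := by
    intro n
    induction n with
    | zero => simpa using sub_mem ha hb
    | succ n ih =>
      have h := nexp_sub_nexp_sub_mem_lowering hW.1 ha hb ih
      rw [hab, sub_self, zero_sub] at h
      exact_mod_cast neg_mem_iff.mp h
  obtain ⟨n, hn⟩ := exists_eq_zero_of_mem_lowering hW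
  exact sub_eq_zero.mp (hn _ (lowering_antitone hW.1 (by lia) (key n)))

theorem nexp_mem (A : Subalgebra K (Module.End K V)) {a : Module.End K V} (ha : a ∈ A) :
    nexp a ∈ A :=
  sum_mem fun _ _ => A.smul_mem (pow_mem ha _) _

theorem exists_nexp_eq {W : ℤ → Submodule K V} (hW : IsIncFilt W)
    (A : Subalgebra K (Module.End K V)) {g : Module.End K V} (hgA : g ∈ A)
    (hg : g - 1 ∈ lowering W 1) :
    ∃ a ∈ lowering W 1, a ∈ A ∧ nexp a = g := by
  have key : ∀ n : ℕ, ∃ a ∈ lowering W 1, a ∈ A ∧ g - nexp a ∈ lowering W (n + 1) := by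
    intro n
    induction n with
    | zero => exact ⟨0, zero_mem _, zero_mem _, by simpa [nexp_zero] using hg⟩
    | succ n ih =>
      obtain ⟨a, ha, haA, hag⟩ := ih
      have hb : a + (g - nexp a) ∈ lowering W 1 :=
        add_mem ha (lowering_antitone hW.1 (by lia) hag)
      refine ⟨_, hb, add_mem haA (sub_mem hgA (nexp_mem A haA)), ?_⟩
      have h := nexp_sub_nexp_sub_mem_lowering hW.1 hb ha (by simpa using hag)
      rw [add_sub_cancel_left, sub_sub_sub_cancel_right] at h
      rw [← neg_sub]
      exact_mod_cast neg_mem h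
  obtain ⟨n, hn⟩ := exists_eq_zero_of_mem_lowering hW
  obtain ⟨a, ha, haA, hag⟩ := key n
  exact ⟨a, ha, haA, (sub_eq_zero.mp (hn _ (lowering_antitone hW.1 (by lia) hag))).symm⟩

end Exponential

section Gradings

variable {K V : Type} [Field K] [AddCommGroup V] [Module K V]

theorem mem_intEig {Y : Module.End K V} {j : ℤ} {v : V} :
    v ∈ intEig Y j ↔ Y v = (j : K) • v := by
  simp [intEig, sub_eq_zero]

theorem intEig_le {Y : Module.End K V} {W : ℤ → Submodule K V} (hY : IsGrading Y W)
    {j k : ℤ} (hjk : j ≤ k) : intEig Y j ≤ W k :=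
  hY.2 k ▸ le_iSup₂_of_le j hjk le_rfl

theorem ext_intEig {Y f g : Module.End K V} (hY : (⨆ j : ℤ, intEig Y j) = ⊤)
    (h : ∀ j, ∀ v ∈ intEig Y j, f v = g v) : f = g := by
  have : (⨆ j : ℤ, intEig Y j) ≤ LinearMap.eqLocus f g := iSup_le fun j v hv => h j v hv
  exact LinearMap.ext fun v => this (by simp [hY])

theorem mem_lowering_of_intEig {Y f : Module.End K V} {W : ℤ → Submodule K V} {m : ℤ}
    (hW : Monotone W) (hY : IsGrading Y W)
    (h : ∀ j, ∀ v ∈ intEig Y j, f v ∈ W (j - m)) : f ∈ lowering W m := by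
  intro k v hv
  rw [hY.2 k] at hv
  have : (⨆ j ≤ k, intEig Y j) ≤ (W (k - m)).comap f :=
    iSup₂_le fun j hj v hv => hW (by lia) (h j v hv)
  exact this hv

theorem aeval_apply_of_mem_intEig {Y : Module.End K V} {j : ℤ} {v : V}
    (hv : v ∈ intEig Y j) (p : Polynomial K) :
    Polynomial.aeval Y p v = p.eval (j : K) • v := by
  rcases eq_or_ne v 0 with rfl | h0
  · simp
  · exact Module.End.aeval_apply_of_hasEigenvector
      ⟨Module.End.mem_eigenspace_iff.mpr (mem_intEig.mp hv), h0⟩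

variable [CharZero K]

theorem disjoint_intEig {Y : Module.End K V} {W : ℤ → Submodule K V} (hY : IsGrading Y W)
    (j : ℤ) : Disjoint (intEig Y j) (W (j - 1)) := by
  have hE : intEig Y = fun j : ℤ => Y.eigenspace (j : K) := by
    ext j v
    rw [mem_intEig, Module.End.mem_eigenspace_iff]
  have h : iSupIndep (intEig Y) :=
    hE ▸ (Module.End.eigenspaces_iSupIndep Y).comp Int.cast_injective
  refine (h j).mono_right ?_
  rw [hY.2]
  exact iSup₂_le fun i hi => le_iSup₂_of_le i (by lia) le_rfl

theorem eq_zero_of_intertwines {W : ℤ → Submodule K V} {Y₁ Y₂ f : Module.End K V}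
    (hY₁ : IsGrading Y₁ W) (hY₂ : IsGrading Y₂ W) (hf : f ∈ lowering W 1)
    (h : f * Y₁ = Y₂ * f) : f = 0 := by
  refine ext_intEig hY₁.1 fun j v hv => ?_
  refine Submodule.disjoint_def.mp (disjoint_intEig hY₂ j) _ (mem_intEig.mpr ?_)
    (hf j v (intEig_le hY₁ le_rfl hv))
  rw [← Module.End.mul_apply, ← h, Module.End.mul_apply, mem_intEig.mp hv, map_smul]

/-- The range of weights of a filtration supports every grading. -/
theorem exists_finset_intEig {W : ℤ → Submodule K V} (hW : IsIncFilt W) :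
    ∃ s : Finset ℤ, ∀ Y : Module.End K V, IsGrading Y W → ∀ j ∉ s, intEig Y j = ⊥ := by
  obtain ⟨-, ⟨a, ha⟩, b, hb⟩ := hW
  refine ⟨Finset.Icc a b, fun Y hY j hj => ?_⟩
  rcases le_or_gt j a with h | h
  · exact le_bot_iff.mp (ha j h ▸ intEig_le hY le_rfl)
  · have hd := disjoint_intEig hY j
    rw [hb (j - 1) (by simp at hj; lia)] at hd
    exact disjoint_top.mp hd

/-- The Lagrange polynomial in `Y` which is the projection onto the `j`-eigenspace when the
eigenvalues of `Y` lie in `s`. -/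
noncomputable def eigProj (s : Finset ℤ) (Y : Module.End K V) (j : ℤ) : Module.End K V :=
  Polynomial.aeval Y (Lagrange.basis s (fun i : ℤ => (i : K)) j)

theorem eigProj_apply_of_mem {s : Finset ℤ} {Y : Module.End K V} {i j : ℤ} {v : V}
    (hj : j ∈ s) (hs : ∀ i ∉ s, intEig Y i = ⊥) (hv : v ∈ intEig Y i) :
    eigProj s Y j v = if i = j then v else 0 := by
  by_cases hi : i ∈ s
  · rw [eigProj, aeval_apply_of_mem_intEig hv]
    split_ifs with hij
    · subst hij
      rw [Lagrange.eval_basis_self (Int.cast_injective.injOn) hi, one_smul]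
    · rw [Lagrange.eval_basis_of_ne (v := fun i : ℤ => (i : K)) (Ne.symm hij) hi, zero_smul]
  · rw [hs i hi, Submodule.mem_bot] at hv
    simp [hv]

theorem exists_intertwiner {W : ℤ → Submodule K V} (hW : IsIncFilt W) {Y₁ Y₂ : Module.End K V}
    (hY₁ : IsGrading Y₁ W) (hY₂ : IsGrading Y₂ W) :
    ∃ g ∈ Algebra.adjoin K {Y₁, Y₂}, g - 1 ∈ lowering W 1 ∧ g * Y₁ = Y₂ * g := by
  obtain ⟨s, hs⟩ := exists_finset_intEig hW
  have h₁ := hs Y₁ hY₁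
  have h₂ := hs Y₂ hY₂
  have happ : ∀ i ∈ s, ∀ v ∈ intEig Y₁ i,
      (∑ j ∈ s, eigProj s Y₂ j * eigProj s Y₁ j) v = eigProj s Y₂ i v := by
    intro i hi v hv
    rw [LinearMap.sum_apply, Finset.sum_eq_single_of_mem i hi]
    · rw [Module.End.mul_apply, eigProj_apply_of_mem hi h₁ hv, if_pos rfl]
    · intro j hj hji
      rw [Module.End.mul_apply, eigProj_apply_of_mem hj h₁ hv, if_neg hji.symm, map_zero]
  have hmul : ∀ j ∈ s, Y₂ * eigProj s Y₂ j = (j : K) • eigProj s Y₂ j := by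
    intro j hj
    refine ext_intEig hY₂.1 fun i v hv => ?_
    rw [Module.End.mul_apply, LinearMap.smul_apply, eigProj_apply_of_mem hj h₂ hv]
    split_ifs with hij
    · exact hij ▸ mem_intEig.mp hv
    · simp
  have hzero : ∀ i ∉ s, ∀ v ∈ intEig Y₁ i, v = 0 := fun i hi v hv => by
    rwa [h₁ i hi, Submodule.mem_bot] at hv
  refine ⟨∑ j ∈ s, eigProj s Y₂ j * eigProj s Y₁ j, ?_, ?_, ?_⟩
  · refine sum_mem fun j _ => mul_mem ?_ ?_
    · exact Algebra.adjoin_mono (by simp) (Polynomial.aeval_mem_adjoin_singleton K Y₂)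
    · exact Algebra.adjoin_mono (by simp) (Polynomial.aeval_mem_adjoin_singleton K Y₁)
  · refine mem_lowering_of_intEig hW.1 hY₁ fun i v hv => ?_
    by_cases hi : i ∈ s
    · rw [LinearMap.sub_apply, happ i hi v hv]
      have hle : (⨆ j ≤ i, intEig Y₂ j) ≤ (W (i - 1)).comap (eigProj s Y₂ i - 1) := by
        refine iSup₂_le fun j hj w hw => ?_
        rw [Submodule.mem_comap, LinearMap.sub_apply, eigProj_apply_of_mem hi h₂ hw]
        split_ifs with hji
        · simp
        · simpa using intEig_le hY₂ (by lia : j ≤ i - 1) hw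
      exact hle (hY₂.2 i ▸ intEig_le hY₁ le_rfl hv)
    · simp [hzero i hi v hv]
  · refine ext_intEig hY₁.1 fun i v hv => ?_
    by_cases hi : i ∈ s
    · rw [Module.End.mul_apply, mem_intEig.mp hv, map_smul, Module.End.mul_apply,
        happ i hi v hv, ← Module.End.mul_apply, hmul i hi, LinearMap.smul_apply]
    · simp [hzero i hi v hv]

end Gradings

/-- Let `W` be an increasing filtration of `V`, `N̂, H ∈ End(V)`, and `Y₁, Y₂`
gradings of `W` commuting with `N̂` and `H`.  Then there is a unique `α ∈ End(V)` with
`α(W_k) ⊆ W_{k-1}`, `[α, N̂] = 0`, `[α, H] = 0` and `exp(α) Y₁ exp(α)⁻¹ = Y₂`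
(such an `α` is nilpotent, so `exp(α)` is a well-defined automorphism): the gradings of `W`
commuting with `N̂` and `H` form a set on which `exp` of the degree `-1` centralizer acts
simply transitively. -/
theorem stmt12 {K V : Type} [Field K] [CharZero K] [AddCommGroup V] [Module K V]
    [FiniteDimensional K V]
    (W : ℤ → Submodule K V) (hW : IsIncFilt W)
    (Nh H : Module.End K V)
    (Y₁ Y₂ : Module.End K V)
    (hY₁ : IsGrading Y₁ W) (hY₂ : IsGrading Y₂ W)
    (hY₁N : Y₁ * Nh = Nh * Y₁) (hY₁H : Y₁ * H = H * Y₁)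
    (hY₂N : Y₂ * Nh = Nh * Y₂) (hY₂H : Y₂ * H = H * Y₂) :
    ∃! α : Module.End K V,
      (∀ k : ℤ, Submodule.map α (W k) ≤ W (k - 1)) ∧
      α * Nh = Nh * α ∧ α * H = H * α ∧
      ∃ β : Module.End K V, nexp α * β = 1 ∧ β * nexp α = 1 ∧
        nexp α * Y₁ * β = Y₂ := by
  obtain ⟨g, hgA, hg, hgY⟩ := exists_intertwiner hW hY₁ hY₂
  have hcomm : ∀ X : Module.End K V, Y₁ * X = X * Y₁ → Y₂ * X = X * Y₂ →
      g ∈ Subalgebra.centralizer K {X} := fun X h₁ h₂ =>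
    Algebra.adjoin_le (by
      rintro Z (rfl | rfl) <;> simp [Set.mem_centralizer_iff, h₁, h₂]) hgA
  obtain ⟨α, hα, ⟨hαN, hαH⟩, rfl⟩ := exists_nexp_eq hW
    (Subalgebra.centralizer K {Nh} ⊓ Subalgebra.centralizer K {H})
    ⟨hcomm Nh hY₁N hY₂N, hcomm H hY₁H hY₂H⟩ hg
  refine ⟨α, ⟨mem_lowering_one_iff.mp hα, (hαN Nh rfl).symm, (hαH H rfl).symm, ?_⟩, ?_⟩
  · have hu : IsUnit (nexp α) := by
      simpa using (isNilpotent_of_mem_lowering hW hg).isUnit_add_one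
    obtain ⟨u, hu⟩ := hu
    refine ⟨↑u⁻¹, by simp [← hu], by simp [← hu], ?_⟩
    rw [hgY, ← hu, mul_assoc, Units.mul_inv, mul_one]
  · rintro α' ⟨hα', -, -, β, -, hβ, hY⟩
    replace hα' := mem_lowering_one_iff.mpr hα'
    have hα'Y : nexp α' * Y₁ = Y₂ * nexp α' := by
      rw [← hY, mul_assoc _ β, hβ, mul_one]
    refine nexp_injOn_lowering hW hα' hα (sub_eq_zero.mp ?_)
    refine eq_zero_of_intertwines hY₁ hY₂ ?_ (by rw [sub_mul, mul_sub, hα'Y, hgY])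
    simpa using sub_mem (nexp_sub_one_mem_lowering hW.1 hα') hg
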